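/- Let (Δ,Θ) be a directive bi-sequence with associated prefixes (w_n), let n ≥ 0, suppose Assumption A holds for (w_n, w_{n+1}), and suppose exactly one pseudopalindromic prefix v is missed between w_n and w_{n+1}. Then one of the following holds: (a) there is i ∈ {0,1,2} such that w_n and w_{n+1} are R-palindromes and v is an E_i-palindrome; (b) there is i ∈ {0,1,2} such that w_n and w_{n+1} are E_i-palindromes and v is an R-palindrome; (c) there are pairwise distinct i, j, k ∈ {0,1,2} such that w_n is an E_i-palindrome, v is an E_j-palindrome and w_{n+1} is an E_k-palindrome. -/

import Mathlib

/-- The ternary alphabet. -/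
abbrev Letter := Fin 3

/-- Finite words over the ternary alphabet. -/
abbrev Word := List Letter

/-- The four involutory antimorphisms of ternary words: the reversal `R`
and, for each letter `i`, the antimorphism `E i`. -/
inductive AM where
  | R : AM
  | E : Letter → AM
deriving DecidableEq

/-- The action of an antimorphism on a single letter: `R` fixes every letter,
and `E i` fixes `i` and exchanges the other two letters (in `Fin 3`,
this involution is `a ↦ -(i + a)`). -/
def AM.letter : AM → Letter → Letter
  | .R, _a => _a
  | .E i, a => -(i + a)

/-- The action of an antimorphism on a word: letterwise image followed by reversal. -/
def AM.apply (t : AM) (w : Word) : Word := (w.map t.letter).reverse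

/-- A word is a pseudopalindrome if it is a `ϑ`-palindrome for some
`ϑ ∈ {R, E_0, E_1, E_2}`. -/
def IsPseudopal (w : Word) : Prop := ∃ t : AM, t.apply w = w

/-- `v` is an image of `w` if `v = ϑ(w)` for some `ϑ ∈ {R, E_0, E_1, E_2}`. -/
def IsImage (w v : Word) : Prop := ∃ t : AM, v = t.apply w

/-- `v` is the `ϑ`-palindromic closure of `u`: the shortest `ϑ`-palindrome
having `u` as a prefix. -/
def IsPalClosure (t : AM) (u v : Word) : Prop :=
  u <+: v ∧ t.apply v = v ∧
    ∀ v' : Word, u <+: v' → t.apply v' = v' → v.length ≤ v'.length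

/-- `w` is the sequence of prefixes associated with the directive bi-sequence
`(Δ, Θ)`: `w 0 = ε` and `w (n+1) = (w n · δ_{n+1})^{ϑ_{n+1}}`. -/
def DirectivePrefixes (Δ : ℕ → Letter) (Θ : ℕ → AM) (w : ℕ → Word) : Prop :=
  w 0 = [] ∧ ∀ n : ℕ, IsPalClosure (Θ (n + 1)) (w n ++ [Δ (n + 1)]) (w (n + 1))

/-- A pseudopalindromic prefix `v` of `w_{n+1}` is missed between `w_n` and `w_{n+1}`
if `|w_n| < |v| < |w_{n+1}|`. -/
def MissedBetween (wn wn1 v : Word) : Prop :=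
  v <+: wn1 ∧ IsPseudopal v ∧ wn.length < v.length ∧ v.length < wn1.length

/-- An image of `u` occurs in `v` at (0-indexed) position `p`. -/
def OccursImageAt (u v : Word) (p : ℕ) : Prop :=
  p + u.length ≤ v.length ∧ IsImage u ((v.drop p).take u.length)

/-- Assumption A for the pair `(wn, wn1)`: some image of `wn` occurs in `wn1`
at a position `p` with `0 < p < |wn1| - |wn|`, overlapping both the prefix
occurrence of `wn` and the suffix occurrence of an image of `wn`. -/
def AssumptionA (wn wn1 : Word) : Prop :=
  ∃ p : ℕ, 0 < p ∧ p < wn1.length - wn.length ∧ p < wn.length ∧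
    wn1.length - wn.length < p + wn.length ∧ OccursImageAt wn wn1 p

/-- The prefix of length `n` of the directive bi-sequence is normalized:
every pseudopalindromic prefix of `w n` equals `w k` for some `k ≤ n`. -/
def NormalizedUpTo (w : ℕ → Word) (n : ℕ) : Prop :=
  ∀ v : Word, v <+: w n → IsPseudopal v → ∃ k : ℕ, k ≤ n ∧ v = w k

/-- `rep u l` is the `l`-fold concatenation `u^l`. -/
def rep (u : Word) (l : ℕ) : Word := (List.replicate l u).flatten

/-- `rmSuf x y` is `x · y⁻¹`: the word `x` with its suffix of length `|y|` removed. -/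
def rmSuf (x y : Word) : Word := x.take (x.length - y.length)

/-- `v` is a prefix of the infinite periodic word `pat^ω`. -/
def IsPrefixOfPow (pat v : Word) : Prop :=
  ∀ q : ℕ, ∀ hq : q < v.length, ∃ hp : q % pat.length < pat.length,
    v.get ⟨q, hq⟩ = pat.get ⟨q % pat.length, hp⟩
/-- The length-`j` prefix of the letter sequence `f` is a `t`-palindrome. -/
def PalPrefix (f : ℕ → Letter) (t : AM) (j : ℕ) : Prop :=
  ∀ k < j, f k = t.letter (f (j - 1 - k))

/-- The `t`-image of the length-`m` prefix of `f` occurs in `f` at position `p`. -/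
def PrefixImageAt (f : ℕ → Letter) (t : AM) (m p : ℕ) : Prop :=
  ∀ k < m, f (p + k) = t.letter (f (m - 1 - k))

instance : Fintype AM where
  elems := {.R, .E 0, .E 1, .E 2}
  complete := by
    rintro (_ | i)
    · decide
    · fin_cases i <;> decide

@[simp]
theorem AM.letter_letter (t : AM) (a : Letter) : t.letter (t.letter a) = a := by
  cases t <;> simp [AM.letter]

/-- If `r s t r` and `t s` agree at one letter, then `r t s` is the letter map
of an antimorphism. -/
theorem AM.exists_letter_eq_of_agree : ∀ r s t : AM, ∀ a : Letter,
    r.letter (s.letter (t.letter (r.letter a))) = t.letter (s.letter a) →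
    ∃ q : AM, ∀ b, q.letter b = r.letter (t.letter (s.letter b)) := by
  decide

theorem AM.types_of_letter_relations : ∀ r s t : AM, ∀ a c : Letter,
    r.letter (t.letter a) = t.letter (s.letter a) →
    r.letter (t.letter (t.letter (s.letter a))) =
      t.letter (s.letter (t.letter (s.letter a))) →
    r.letter (t.letter c) = t.letter (s.letter c) →
    (r.letter c ≠ t.letter c ∨ r.letter (t.letter c) ≠ c) →
    (∃ i, s = .R ∧ r = .R ∧ t = .E i) ∨ (∃ i, s = .E i ∧ r = .E i ∧ t = .R) ∨
      ∃ i j k, i ≠ j ∧ j ≠ k ∧ i ≠ k ∧ s = .E i ∧ t = .E j ∧ r = .E k := by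
  decide

theorem PrefixImageAt.palPrefix {f : ℕ → Letter} {t : AM} {m p : ℕ}
    (h : PrefixImageAt f t m p) (hp : p ≤ m) : PalPrefix f t (p + m) := by
  intro k hk
  rcases lt_or_ge k m with hkm | hkm
  · have := h (m - 1 - k) (by omega)
    rw [show p + (m - 1 - k) = p + m - 1 - k by omega,
      show m - 1 - (m - 1 - k) = k by omega] at this
    rw [this, AM.letter_letter]
  · have := h (k - p) (by omega)
    rwa [show p + (k - p) = k by omega,
      show m - 1 - (k - p) = p + m - 1 - k by omega] at this

/-- In an `r`-palindrome of length `D + m`, the mirror of an overlapping occurrence of an image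
of the prefix of length `m` is again an occurrence of an image of that prefix. -/
theorem PrefixImageAt.mirror {f : ℕ → Letter} {r s t : AM} {m p D : ℕ}
    (hs : PalPrefix f s m) (hr : PalPrefix f r (D + m)) (h : PrefixImageAt f t m p)
    (hpm : p < m) (hpD : p < D) (hDm : D < p + m) :
    ∃ q : AM, PrefixImageAt f q m (D - p) := by
  have shift : ∀ k < m, f (p + k) = t.letter (s.letter (f k)) := by
    intro k hk
    rw [h k hk, hs k hk, AM.letter_letter]
  obtain ⟨q, hq⟩ := AM.exists_letter_eq_of_agree r s t (f (D - p)) (by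
    have h1 := shift (D - p) (by omega)
    have h2 := hr (D - p) (by omega)
    have h3 := hr D (by omega)
    have h4 := shift (m - 1) (by omega)
    rw [show p + (D - p) = D by omega] at h1
    rw [show D + m - 1 - (D - p) = p + (m - 1) by omega] at h2
    rw [show D + m - 1 - D = m - 1 by omega] at h3
    rw [← h1, h2, h3, h4]
    simp)
  refine ⟨q, fun k hk => ?_⟩
  have h1 := hr (D - p + k) (by omega)
  have h2 := h (m - 1 - k) (by omega)
  rw [show D + m - 1 - (D - p + k) = p + (m - 1 - k) by omega] at h1
  rw [show m - 1 - (m - 1 - k) = k by omega] at h2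
  rw [h1, h2, hq, hs k hk]

/-- Letter-sequence form of the classification: the middle image sits at distance `p` from both
ends, and the palindrome of length `p + m` is not of the same type as the whole word. -/
theorem types_of_centered_image {f : ℕ → Letter} {r s t : AM} {m p : ℕ}
    (hs : PalPrefix f s m) (hr : PalPrefix f r (p + p + m)) (h : PrefixImageAt f t m p)
    (hpm : p < m) (hv : ¬ PalPrefix f r (p + m)) :
    (∃ i, s = .R ∧ r = .R ∧ t = .E i) ∨ (∃ i, s = .E i ∧ r = .E i ∧ t = .R) ∨
      ∃ i j k, i ≠ j ∧ j ≠ k ∧ i ≠ k ∧ s = .E i ∧ t = .E j ∧ r = .E k := by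
  have ht := h.palPrefix hpm.le
  have shift : ∀ k < m, f (p + k) = t.letter (s.letter (f k)) := by
    intro k hk
    rw [h k hk, hs k hk, AM.letter_letter]
  have rel : ∀ k < m, r.letter (t.letter (f k)) = t.letter (s.letter (f k)) := by
    intro k hk
    have h1 := hr (p + k) (by omega)
    have h2 := h (m - 1 - k) (by omega)
    rw [show p + p + m - 1 - (p + k) = p + (m - 1 - k) by omega] at h1
    rw [show m - 1 - (m - 1 - k) = k by omega] at h2
    rw [← shift k hk, h1, h2]
  have rel' := rel p hpm
  rw [show f p = t.letter (s.letter (f 0)) by simpa using shift 0 (by omega)] at rel'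
  simp only [PalPrefix, not_forall] at hv
  obtain ⟨k, hk, hne⟩ := hv
  have htk := ht k hk
  rcases lt_or_ge k m with hkm | hkm
  · refine AM.types_of_letter_relations r s t (f 0) (f k) (rel 0 (by omega)) rel' (rel k hkm) ?_
    right
    intro he
    apply hne
    have : t.letter (f k) = f (p + m - 1 - k) := by rw [htk, AM.letter_letter]
    rw [← this, he]
  · refine AM.types_of_letter_relations r s t (f 0) (f (p + m - 1 - k)) (rel 0 (by omega)) rel'
      (rel _ (by omega)) ?_
    left
    intro he
    exact hne (htk.trans he.symm)

theorem AM.length_apply (t : AM) (l : Word) : (t.apply l).length = l.length := by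
  simp [AM.apply]

theorem AM.getD_apply (t : AM) {l : Word} {k : ℕ} (hk : k < l.length) :
    (t.apply l).getD k 0 = t.letter (l.getD (l.length - 1 - k) 0) := by
  have h2 : l.length - 1 - k < l.length := by omega
  simp [AM.apply, List.getD_eq_getElem?_getD, hk, h2]

theorem getD_take {l : Word} {j k : ℕ} (h : k < j) : (l.take j).getD k 0 = l.getD k 0 := by
  simp [List.getD_eq_getElem?_getD, h]

theorem AM.apply_take_eq_iff (t : AM) {l : Word} {j : ℕ} (hj : j ≤ l.length) :
    t.apply (l.take j) = l.take j ↔ PalPrefix (l.getD · 0) t j := by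
  have hlen : (l.take j).length = j := by simp [hj]
  constructor
  · intro h k hk
    have h1 := t.getD_apply (l := l.take j) (k := k) (by omega)
    rwa [h, hlen, getD_take hk, getD_take (by omega)] at h1
  · intro h
    refine List.ext_getElem (AM.length_apply _ _) fun k hk hk' => ?_
    rw [← List.getD_eq_getElem _ 0, ← List.getD_eq_getElem _ 0, AM.getD_apply t hk', hlen,
      getD_take (by omega), getD_take (by omega)]
    exact (h k (by omega)).symm

theorem prefixImageAt_of_take_drop {t : AM} {l : Word} {m p : ℕ} (hl : p + m ≤ l.length)
    (h : (l.drop p).take m = t.apply (l.take m)) : PrefixImageAt (l.getD · 0) t m p := by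
  intro k hk
  have hlen : (l.take m).length = m := by simp; omega
  have h1 := t.getD_apply (l := l.take m) (k := k) (by omega)
  rw [← h, hlen, getD_take hk, getD_take (by omega)] at h1
  rw [← h1]
  simp [List.getD_eq_getElem?_getD]

/-- Corollary (one missed prefix): if exactly one pseudopalindromic prefix `v` is
missed between `w n` and `w (n+1)` and Assumption A holds, then the palindromic
types of `w n`, `v`, `w (n+1)` are successively `R`, `E_i`, `R`, or `E_i`, `R`,
`E_i`, or `E_i`, `E_j`, `E_k` with `i, j, k` pairwise distinct. -/
theorem types_when_one_prefix_missed
    (Δ : ℕ → Letter) (Θ : ℕ → AM) (w : ℕ → Word)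
    (hw : DirectivePrefixes Δ Θ w) (n : ℕ)
    (hA : AssumptionA (w n) (w (n + 1)))
    (v : Word) (hv : MissedBetween (w n) (w (n + 1)) v)
    (huniq : ∀ v' : Word, MissedBetween (w n) (w (n + 1)) v' → v' = v) :
    (∃ i : Letter, AM.R.apply (w n) = w n ∧ AM.R.apply (w (n + 1)) = w (n + 1) ∧
      (AM.E i).apply v = v) ∨
    (∃ i : Letter, (AM.E i).apply (w n) = w n ∧
      (AM.E i).apply (w (n + 1)) = w (n + 1) ∧ AM.R.apply v = v) ∨
    (∃ i j k : Letter, i ≠ j ∧ j ≠ k ∧ i ≠ k ∧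
      (AM.E i).apply (w n) = w n ∧ (AM.E j).apply v = v ∧
      (AM.E k).apply (w (n + 1)) = w (n + 1)) := by
  obtain ⟨p, hp0, hpD, hpm, hDm, hpl, t, ht⟩ := hA
  obtain ⟨hpre, hrW, hmin⟩ := hw.2 n
  have hn : n ≠ 0 := by
    rintro rfl
    rw [hw.1] at hpm
    simp at hpm
  have hsU : (Θ n).apply (w n) = w n := by
    obtain ⟨k, rfl⟩ := Nat.exists_eq_succ_of_ne_zero hn
    exact (hw.2 k).2.1
  generalize Θ n = s at hsU
  generalize Θ (n + 1) = r at *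
  generalize hW : w (n + 1) = W at *
  obtain ⟨m, hm⟩ : ∃ m, (w n).length = m := ⟨_, rfl⟩
  have hU : w n = W.take m := by
    rw [← hm]
    exact List.prefix_iff_eq_take.1 ((List.prefix_append _ _).trans hpre)
  obtain ⟨D, hD⟩ : ∃ D, W.length = D + m := ⟨W.length - m, by omega⟩
  rw [hm] at hpD hpm hDm hpl ht
  rw [hU] at ht
  have hocc := prefixImageAt_of_take_drop (by omega) ht
  have hs : PalPrefix (W.getD · 0) s m := by
    rw [← AM.apply_take_eq_iff s (by omega), ← hU, hsU]
  have hr : PalPrefix (W.getD · 0) r (D + m) := by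
    rw [← AM.apply_take_eq_iff r (by omega), ← hD, List.take_length, hrW]
  have missed : ∀ (q : AM) (x : ℕ), 0 < x → x < D → PalPrefix (W.getD · 0) q (x + m) →
      W.take (x + m) = v := by
    intro q x h0 hx hq
    refine huniq _ ⟨⟨_, List.take_append_drop _ _⟩, ⟨q, ?_⟩, ?_, ?_⟩
    · rwa [AM.apply_take_eq_iff q (by omega)]
    · rw [hm, List.length_take]; omega
    · rw [List.length_take]; omega
  have htv := hocc.palPrefix hpm.le
  have hvp := missed t p hp0 (by omega) htv
  obtain ⟨q, hq⟩ := hocc.mirror hs hr hpm (by omega) (by omega)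
  have hvp' := missed q (D - p) (by omega) (by omega) (hq.palPrefix (by omega))
  have hDp : D = p + p := by
    have := congrArg List.length (hvp.trans hvp'.symm)
    simp only [List.length_take] at this
    omega
  subst hDp
  have hnot : ¬ PalPrefix (W.getD · 0) r (p + m) := by
    intro hc
    have := hmin (W.take (p + m))
      (List.prefix_of_prefix_length_le hpre ⟨_, List.take_append_drop _ _⟩ (by
        simp only [List.length_append, List.length_take, List.length_singleton]; omega))
      ((AM.apply_take_eq_iff r (by omega)).2 hc)
    rw [List.length_take] at this
    omega
  have htv' : t.apply v = v := by
    rw [← hvp]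
    exact (AM.apply_take_eq_iff t (by omega)).2 htv
  rcases types_of_centered_image hs hr hocc hpm hnot with
    ⟨i, rfl, rfl, rfl⟩ | ⟨i, rfl, rfl, rfl⟩ | ⟨i, j, k, hij, hjk, hik, rfl, rfl, rfl⟩
  · exact Or.inl ⟨i, hsU, hrW, htv'⟩
  · exact Or.inr (Or.inl ⟨i, hsU, hrW, htv'⟩)
  · exact Or.inr (Or.inr ⟨i, j, k, hij, hjk, hik, hsU, htv', hrW⟩)
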